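/- arXiv:2505.11836 — 6 statements merged into one kernel-verified Lean document; each statement's English description precedes it below -/
import Mathlib

section
/- Let μ_1,…,μ_k ∈ ℝⁿ and α_1,…,α_k ∈ ℝ define a K-th order power diagram with cells C_S indexed by the K-subsets S of {1,…,k}. Define ν_S := (1/K) Σ_{i∈S} μ_i and β_S := ‖(1/K) Σ_{i∈S} μ_i‖₂² − (1/K) Σ_{i∈S} ‖μ_i‖₂² + (1/K) Σ_{i∈S} α_i, and let R_S := {x ∈ ℝⁿ : ‖x − ν_S‖₂² − β_S < ‖x − ν_T‖₂² − β_T for all K-subsets T ≠ S of {1,…,k}}. Then R_S = C_S for every K-subset S; that is, every K-th order power diagram is a power diagram. -/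
open Finset

/-- The centroid `ν_S := (1/K) Σ_{i∈S} μ_i`. -/
noncomputable def nuS (n k K : ℕ) (μ : Fin k → Fin n → ℝ) (S : Finset (Fin k)) :
    Fin n → ℝ :=
  fun j => (K : ℝ)⁻¹ * ∑ i ∈ S, μ i j

/-- The weight `β_S := ‖ν_S‖² − (1/K) Σ_{i∈S} ‖μ_i‖² + (1/K) Σ_{i∈S} α_i`. -/
noncomputable def betaS (n k K : ℕ) (μ : Fin k → Fin n → ℝ) (α : Fin k → ℝ)
    (S : Finset (Fin k)) : ℝ :=
  (∑ j, (nuS n k K μ S j) ^ 2) - (K : ℝ)⁻¹ * ∑ i ∈ S, (∑ l, (μ i l) ^ 2)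
    + (K : ℝ)⁻¹ * ∑ i ∈ S, α i

/-- A set `S` is the unique minimizer of `T ↦ ∑ i ∈ T, d i` among the sets of its cardinality
exactly when `d` is strictly smaller at every point of `S` than at every point outside `S`. -/
theorem sum_lt_sum_of_card_eq_iff {ι : Type*} [DecidableEq ι] (d : ι → ℝ) (S : Finset ι) :
    (∀ T : Finset ι, T.card = S.card → T ≠ S → ∑ i ∈ S, d i < ∑ i ∈ T, d i) ↔
      ∀ i ∈ S, ∀ j ∉ S, d i < d j := by
  constructor
  · intro h i hi j hj
    have hj' : j ∉ S.erase i := fun hmem => hj (mem_of_mem_erase hmem)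
    have hlt := h (insert j (S.erase i))
      (by rw [card_insert_of_notMem hj', card_erase_add_one hi])
      (fun heq => hj (heq ▸ mem_insert_self j _))
    rw [sum_insert hj', ← add_sum_erase S d hi] at hlt
    linarith
  · intro h T hT hne
    have hcard : (S \ T).card = (T \ S).card := card_sdiff_comm hT.symm
    have hTS : (T \ S).Nonempty :=
      sdiff_nonempty.mpr fun hsub => hne (eq_of_subset_of_card_le hsub hT.ge)
    have hST : (S \ T).Nonempty := card_pos.mp (hcard ▸ card_pos.mpr hTS)
    obtain ⟨m, hm, hmax⟩ := exists_max_image (S \ T) d hST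
    have hle : ∑ i ∈ S \ T, d i ≤ (S \ T).card • d m := sum_le_card_nsmul _ _ _ hmax
    have hlt : ∑ _i ∈ T \ S, d m < ∑ i ∈ T \ S, d i :=
      sum_lt_sum_of_nonempty hTS fun j hj =>
        h m (mem_sdiff.mp hm).1 j (mem_sdiff.mp hj).2
    rw [sum_const, ← hcard] at hlt
    rw [← sum_inter_add_sum_sdiff S T d, ← sum_inter_add_sum_sdiff T S d, inter_comm T S]
    linarith

/-- The power distance to `nuS` with weight `betaS` is the average over `T` of the power
distances to the `μ i` with weights `α i`. -/
theorem power_nuS_betaS_eq_average (n k K : ℕ) (hK : 1 ≤ K) (μ : Fin k → Fin n → ℝ)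
    (α : Fin k → ℝ) (T : Finset (Fin k)) (hT : T.card = K) (x : Fin n → ℝ) :
    (∑ j, (x j - nuS n k K μ T j) ^ 2) - betaS n k K μ α T
      = (K : ℝ)⁻¹ * ∑ i ∈ T, ((∑ l, (x l - μ i l) ^ 2) - α i) := by
  have hK0 : (K : ℝ) ≠ 0 := by positivity
  have hsq : ∑ i ∈ T, ∑ l, (x l - μ i l) ^ 2
      = K * (∑ l, x l ^ 2) - 2 * (∑ l, x l * ∑ i ∈ T, μ i l) + ∑ i ∈ T, ∑ l, μ i l ^ 2 := by
    have hcross : ∑ l, x l * ∑ i ∈ T, μ i l = ∑ i ∈ T, ∑ l, x l * μ i l := by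
      simp_rw [mul_sum]
      exact sum_comm
    simp_rw [hcross, sub_sq, sum_add_distrib, sum_sub_distrib, mul_assoc, ← mul_sum,
      sum_const, hT, nsmul_eq_mul]
  have hnu : ∑ j, (x j - nuS n k K μ T j) ^ 2
      = (∑ l, x l ^ 2) - 2 * ((K : ℝ)⁻¹ * ∑ l, x l * ∑ i ∈ T, μ i l)
        + ∑ j, nuS n k K μ T j ^ 2 := by
    rw [mul_sum, mul_sum, ← sum_sub_distrib, ← sum_add_distrib]
    refine sum_congr rfl fun j _ => ?_
    simp only [nuS]
    ring
  rw [hnu, betaS, sum_sub_distrib, hsq]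
  field_simp
  ring

/-- Every `K`-th order power diagram is a power diagram: the cell `R_S` of the power
diagram with centroids `ν_S` and weights `β_S` equals the `K`-th order cell `C_S`. -/
theorem kth_order_power_diagram_is_power_diagram
    (n k K : ℕ) (hK1 : 1 ≤ K) (hKk : K ≤ k)
    (μ : Fin k → Fin n → ℝ) (α : Fin k → ℝ)
    (S : Finset (Fin k)) (hS : S.card = K) :
    {x : Fin n → ℝ | ∀ T : Finset (Fin k), T.card = K → T ≠ S →
        (∑ j, (x j - nuS n k K μ S j) ^ 2) - betaS n k K μ α S
          < (∑ j, (x j - nuS n k K μ T j) ^ 2) - betaS n k K μ α T}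
      = {x : Fin n → ℝ | ∀ i ∈ S, ∀ j ∉ S,
        (∑ l, (x l - μ i l) ^ 2) - α i < (∑ l, (x l - μ j l) ^ 2) - α j} := by
  ext x
  simp only [Set.mem_ofPred_eq]
  rw [← sum_lt_sum_of_card_eq_iff (fun i => (∑ l, (x l - μ i l) ^ 2) - α i) S, hS]
  refine forall_congr' fun T => forall_congr' fun hT => forall_congr' fun _ => ?_
  rw [power_nuS_betaS_eq_average n k K hK1 μ α S hS x,
    power_nuS_betaS_eq_average n k K hK1 μ α T hT x]
  exact mul_lt_mul_iff_right₀ (by positivity)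
end

section
/- Let W_enc ∈ ℝ^{d×n}, b_enc ∈ ℝ^d and 1 ≤ K ≤ d. Define centroids μ_i := W_encᵀ e_i ∈ ℝⁿ (the i-th row of W_enc viewed as a vector) and weights α_i := 2 (b_enc)_i + ‖W_encᵀ e_i‖₂² for i = 1,…,d. Then for every K-subset S of {1,…,d}, the region Ω_S^TopK equals the cell C_S of the K-th order power diagram with centroids μ_1,…,μ_d and weights α_1,…,α_d. In particular, the cells {Ω_S^TopK} form a K-th order power diagram with binom(d,K) cells. -/
open Finset

/-- The power distance to a row of `W`, with weight `2 bᵢ + ‖Wᵢ‖²`, is `‖x‖² - 2 (W x + b)ᵢ`. -/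
lemma power_distance_row_eq {ι κ : Type*} [Fintype κ] (W : Matrix ι κ ℝ) (b : ι → ℝ)
    (x : κ → ℝ) (i : ι) :
    (∑ l, (x l - W i l) ^ 2) - (2 * b i + ∑ l, (W i l) ^ 2)
      = (∑ l, (x l) ^ 2) - 2 * (W.mulVec x + b) i := by
  have expand : ∑ l, (x l - W i l) ^ 2
      = (∑ l, (x l) ^ 2) - 2 * (∑ l, W i l * x l) + ∑ l, (W i l) ^ 2 := by
    rw [Finset.mul_sum, ← Finset.sum_sub_distrib, ← Finset.sum_add_distrib]
    exact Finset.sum_congr rfl fun l _ => by ring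
  simp only [Pi.add_apply, Matrix.mulVec, dotProduct, expand]
  ring

/-- With centroids `μ_i := W_encᵀ e_i` (the rows of `W_enc`) and weights
`α_i := 2 (b_enc)_i + ‖W_encᵀ e_i‖²`, each region `Ω_S^TopK` equals the cell `C_S`
of the `K`-th order power diagram with these centroids and weights; in particular
the cells `{Ω_S^TopK}` form a `K`-th order power diagram. -/
theorem topK_cells_form_kth_order_power_diagram
    (d n K : ℕ) (hK1 : 1 ≤ K) (hKd : K ≤ d)
    (Wenc : Matrix (Fin d) (Fin n) ℝ) (benc : Fin d → ℝ)
    (μ : Fin d → Fin n → ℝ) (α : Fin d → ℝ)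
    (hμ : ∀ i, μ i = fun j => Wenc i j)
    (hα : ∀ i, α i = 2 * benc i + ∑ j, (Wenc i j) ^ 2) :
    ∀ S : Finset (Fin d), S.card = K →
      {x : Fin n → ℝ | ∀ i ∈ S, ∀ j ∉ S,
          (Wenc.mulVec x + benc) j < (Wenc.mulVec x + benc) i}
        = {x : Fin n → ℝ | ∀ i ∈ S, ∀ j ∉ S,
          (∑ l, (x l - μ i l) ^ 2) - α i < (∑ l, (x l - μ j l) ^ 2) - α j} := by
  intro S _
  ext x
  simp only [Set.mem_ofPred_eq, hμ, hα, power_distance_row_eq, sub_lt_sub_iff_left,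
    mul_lt_mul_iff_right₀ (two_pos : (0 : ℝ) < 2)]
end

section
/- Let μ_1,…,μ_d ∈ ℝⁿ and α_1,…,α_d ∈ ℝ define a K-th order power diagram with cells C_S indexed by K-subsets S of {1,…,d}. Define W_enc ∈ ℝ^{d×n} by e_iᵀ W_enc = μ_iᵀ (i.e. the i-th row of W_enc is μ_i) and b_enc ∈ ℝ^d by (b_enc)_i = α_i/2 − ‖μ_i‖₂²/2, for i = 1,…,d. Then Ω_S^TopK = C_S for every K-subset S; that is, every K-th order power diagram arises as the collection of affine pieces of a TopK sparse autoencoder encoder. -/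
open Finset

/-- Every `K`-th order power diagram arises as the collection of affine pieces of a
TopK SAE encoder: with `W_enc` having rows `μ_i` and `(b_enc)_i := α_i/2 − ‖μ_i‖²/2`,
each TopK region `Ω_S^TopK` equals the `K`-th order power diagram cell `C_S`. -/
theorem kth_order_power_diagram_from_topK_encoder
    (d n K : ℕ) (hK1 : 1 ≤ K) (hKd : K ≤ d)
    (μ : Fin d → Fin n → ℝ) (α : Fin d → ℝ)
    (Wenc : Matrix (Fin d) (Fin n) ℝ) (benc : Fin d → ℝ)
    (hW : ∀ i j, Wenc i j = μ i j)
    (hb : ∀ i, benc i = α i / 2 - (∑ l, (μ i l) ^ 2) / 2) :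
    ∀ S : Finset (Fin d), S.card = K →
      {x : Fin n → ℝ | ∀ i ∈ S, ∀ j ∉ S,
          (Wenc.mulVec x + benc) j < (Wenc.mulVec x + benc) i}
        = {x : Fin n → ℝ | ∀ i ∈ S, ∀ j ∉ S,
          (∑ l, (x l - μ i l) ^ 2) - α i < (∑ l, (x l - μ j l) ^ 2) - α j} := by
  intro S _
  have power_eq (x : Fin n → ℝ) (i : Fin d) : (∑ l, (x l - μ i l) ^ 2) - α i
      = (∑ l, (x l) ^ 2) - 2 * (Wenc.mulVec x + benc) i := by
    have expand : ∑ l, (x l - μ i l) ^ 2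
        = (∑ l, (x l) ^ 2) - 2 * (∑ l, μ i l * x l) + ∑ l, (μ i l) ^ 2 := by
      rw [Finset.mul_sum, ← Finset.sum_sub_distrib, ← Finset.sum_add_distrib]
      exact Finset.sum_congr rfl fun l _ => by ring
    simp only [Pi.add_apply, Matrix.mulVec, dotProduct, hW, hb, expand]
    ring
  ext x
  simp only [Set.mem_ofPred_eq, power_eq, sub_lt_sub_iff_left,
    mul_lt_mul_iff_right₀ (zero_lt_two' ℝ)]
end

section
/- Let x¹,…,x^N ∈ ℝⁿ with N ≥ 1, let x̄ := (1/N) Σ_{r=1}^N x^r, and let X := (1/N) Σ_{r=1}^N (x^r − x̄)(x^r − x̄)ᵀ be the empirical covariance matrix. Let U, V ∈ ℝ^{n×K} with UᵀU = I_K. Then Σ_{r=1}^N ‖(I − UVᵀ)(x^r − x̄)‖₂² = N·tr(X) + N·tr((V − U)ᵀ X (V − U)) − N·tr(Uᵀ X U). -/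
open Finset Matrix

/-- The trace of a rank-one matrix compressed by `W` is a squared norm. -/
lemma trace_transpose_mul_vecMulVec_mul {m k R : Type*} [Fintype m] [Fintype k] [CommRing R]
    (W : Matrix m k R) (y : m → R) :
    (Wᵀ * vecMulVec y y * W).trace = (Wᵀ *ᵥ y) ⬝ᵥ (Wᵀ *ᵥ y) := by
  rw [mul_vecMulVec, vecMulVec_mul, trace_vecMulVec, mulVec_transpose]

/-- Reconstruction error of a single vector when `U` has orthonormal columns. -/
lemma dotProduct_sub_mulVec_self {m k R : Type*} [Fintype m] [Fintype k] [DecidableEq k]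
    [CommRing R] (U V : Matrix m k R) (hU : Uᵀ * U = 1) (y : m → R) :
    (y - (U * Vᵀ) *ᵥ y) ⬝ᵥ (y - (U * Vᵀ) *ᵥ y)
      = y ⬝ᵥ y + ((V - U)ᵀ *ᵥ y) ⬝ᵥ ((V - U)ᵀ *ᵥ y) - (Uᵀ *ᵥ y) ⬝ᵥ (Uᵀ *ᵥ y) := by
  have cross : y ⬝ᵥ (U *ᵥ (Vᵀ *ᵥ y)) = (Uᵀ *ᵥ y) ⬝ᵥ (Vᵀ *ᵥ y) := by
    rw [dotProduct_mulVec, mulVec_transpose U]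
  have isometry : (U *ᵥ (Vᵀ *ᵥ y)) ⬝ᵥ (U *ᵥ (Vᵀ *ᵥ y)) = (Vᵀ *ᵥ y) ⬝ᵥ (Vᵀ *ᵥ y) := by
    rw [dotProduct_mulVec, ← mulVec_transpose, mulVec_mulVec, hU, one_mulVec]
  rw [← mulVec_mulVec, transpose_sub, sub_mulVec]
  simp only [sub_dotProduct, dotProduct_sub]
  rw [isometry, dotProduct_comm (U *ᵥ (Vᵀ *ᵥ y)) y, cross,
    dotProduct_comm (Vᵀ *ᵥ y) (Uᵀ *ᵥ y)]
  ring

/-- For `U, V ∈ ℝ^{n×K}` with `UᵀU = I`, the reconstruction error satisfies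
`Σ_r ‖(I − UVᵀ)(x^r − x̄)‖² = N·tr(X) + N·tr((V−U)ᵀX(V−U)) − N·tr(UᵀXU)`,
where `X` is the empirical covariance matrix. -/
theorem reconstruction_error_trace_identity
    (n N K : ℕ) (hN : 1 ≤ N) (x : Fin N → Fin n → ℝ)
    (xbar : Fin n → ℝ) (hxbar : xbar = (N : ℝ)⁻¹ • ∑ r, x r)
    (X : Matrix (Fin n) (Fin n) ℝ)
    (hX : X = (N : ℝ)⁻¹ • ∑ r, Matrix.vecMulVec (x r - xbar) (x r - xbar))
    (U V : Matrix (Fin n) (Fin K) ℝ) (hU : Uᵀ * U = 1) :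
    ∑ r, ∑ i, ((x r i - xbar i) - (U * Vᵀ).mulVec (x r - xbar) i) ^ 2
      = N * X.trace + N * ((V - U)ᵀ * X * (V - U)).trace - N * (Uᵀ * X * U).trace := by
  have hN' : (N : ℝ) ≠ 0 := Nat.cast_ne_zero.mpr (by omega)
  have hNX : (N : ℝ) • X = ∑ r, vecMulVec (x r - xbar) (x r - xbar) := by
    rw [hX, smul_inv_smul₀ hN']
  have compressed (W : Matrix (Fin n) (Fin K) ℝ) : N * (Wᵀ * X * W).trace
      = ∑ r, (Wᵀ *ᵥ (x r - xbar)) ⬝ᵥ (Wᵀ *ᵥ (x r - xbar)) := by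
    rw [← smul_eq_mul, ← trace_smul, ← Matrix.smul_mul, ← Matrix.mul_smul, hNX, Matrix.mul_sum,
      Matrix.sum_mul, trace_sum]
    simp only [trace_transpose_mul_vecMulVec_mul]
  have total : N * X.trace = ∑ r, (x r - xbar) ⬝ᵥ (x r - xbar) := by
    rw [← smul_eq_mul, ← trace_smul, hNX, trace_sum]
    simp only [trace_vecMulVec]
  rw [total, compressed, compressed, ← sum_add_distrib, ← sum_sub_distrib]
  refine sum_congr rfl fun r _ => ?_
  rw [← dotProduct_sub_mulVec_self U V hU]
  simp only [dotProduct, Pi.sub_apply, sq]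
end

section
/- Let x¹,…,x^N ∈ ℝⁿ and z¹,…,z^N ∈ ℝ^d with N ≥ 1, let x̄ and z̄ denote their respective means, let W ∈ ℝ^{n×d}, b₀ ∈ ℝⁿ, and ν, β ≥ 0. Then b* := (ν/(N+β+ν)) b₀ + (N/(N+β+ν))(x̄ − W z̄) is the unique minimizer over b ∈ ℝⁿ of the objective Σ_{r=1}^N ‖W z^r + b − x^r‖₂² + ν ‖b − b₀‖₂² + β ‖b‖₂². -/
open Finset

/-- The decoder-bias objective
`Σ_r ‖W z^r + b − x^r‖² + ν‖b − b₀‖² + β‖b‖²`. -/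
noncomputable def biasObj (n d N : ℕ) (x : Fin N → Fin n → ℝ) (z : Fin N → Fin d → ℝ)
    (W : Matrix (Fin n) (Fin d) ℝ) (b0 : Fin n → ℝ) (ν β : ℝ) (b : Fin n → ℝ) : ℝ :=
  (∑ r, ∑ i, (W.mulVec (z r) i + b i - x r i) ^ 2)
    + ν * (∑ i, (b i - b0 i) ^ 2) + β * ∑ i, (b i) ^ 2

/-- At a stationary point `c` the objective is `biasObj c` plus a multiple of `‖b - c‖²`. -/
theorem biasObj_eq_add_of_stationary {n d N : ℕ} {x : Fin N → Fin n → ℝ} {z : Fin N → Fin d → ℝ}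
    {W : Matrix (Fin n) (Fin d) ℝ} {b0 : Fin n → ℝ} {ν β : ℝ} {c : Fin n → ℝ}
    (hc : ∀ i, ∑ r, (W.mulVec (z r) i + c i - x r i) + ν * (c i - b0 i) + β * c i = 0)
    (b : Fin n → ℝ) :
    biasObj n d N x z W b0 ν β b =
      biasObj n d N x z W b0 ν β c + (N + β + ν) * ∑ i, (b i - c i) ^ 2 := by
  unfold biasObj
  rw [sum_comm, sum_comm (s := univ (α := Fin N))]
  simp only [mul_sum, ← sum_add_distrib]
  refine sum_congr rfl fun i _ => ?_
  have expand : ∑ r, (W.mulVec (z r) i + b i - x r i) ^ 2 =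
      ∑ r, (W.mulVec (z r) i + c i - x r i) ^ 2
        + 2 * (b i - c i) * ∑ r, (W.mulVec (z r) i + c i - x r i) + N * (b i - c i) ^ 2 := by
    have hconst : (N : ℝ) * (b i - c i) ^ 2 = ∑ _r : Fin N, (b i - c i) ^ 2 := by simp
    rw [hconst, mul_sum, ← sum_add_distrib, ← sum_add_distrib]
    exact sum_congr rfl fun r _ => by ring
  rw [expand]
  linear_combination 2 * (b i - c i) * hc i

/-- `b* = (ν/(N+β+ν)) b₀ + (N/(N+β+ν))(x̄ − W z̄)` is the unique minimizer of the
decoder-bias objective. -/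
theorem optimal_decoder_bias
    (n d N : ℕ) (hN : 1 ≤ N)
    (x : Fin N → Fin n → ℝ) (z : Fin N → Fin d → ℝ)
    (xbar : Fin n → ℝ) (hxbar : xbar = (N : ℝ)⁻¹ • ∑ r, x r)
    (zbar : Fin d → ℝ) (hzbar : zbar = (N : ℝ)⁻¹ • ∑ r, z r)
    (W : Matrix (Fin n) (Fin d) ℝ) (b0 : Fin n → ℝ)
    (ν β : ℝ) (hν : 0 ≤ ν) (hβ : 0 ≤ β)
    (bstar : Fin n → ℝ)
    (hbstar : bstar = (ν / ((N : ℝ) + β + ν)) • b0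
        + ((N : ℝ) / ((N : ℝ) + β + ν)) • (xbar - W.mulVec zbar)) :
    (∀ b : Fin n → ℝ,
      biasObj n d N x z W b0 ν β bstar ≤ biasObj n d N x z W b0 ν β b) ∧
    (∀ b : Fin n → ℝ,
      biasObj n d N x z W b0 ν β b = biasObj n d N x z W b0 ν β bstar → b = bstar) := by
  have hNpos : (0 : ℝ) < N := by exact_mod_cast hN
  have hpos : 0 < (N : ℝ) + β + ν := by positivity
  have stationary : ∀ i, ∑ r, (W.mulVec (z r) i + bstar i - x r i)
      + ν * (bstar i - b0 i) + β * bstar i = 0 := by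
    intro i
    have hx : ∑ r, x r i = N * xbar i := by
      simp [hxbar, hNpos.ne']
    have hz : ∑ r, W.mulVec (z r) i = N * W.mulVec zbar i := by
      simp [hzbar, Matrix.mulVec_smul, Matrix.mulVec_sum, hNpos.ne']
    have hb : ((N : ℝ) + β + ν) * bstar i = ν * b0 i + N * (xbar i - W.mulVec zbar i) := by
      simp only [hbstar, Pi.add_apply, Pi.smul_apply, Pi.sub_apply, smul_eq_mul]
      field_simp
    rw [sum_sub_distrib, sum_add_distrib, hx, hz]
    simp only [sum_const, card_univ, Fintype.card_fin, nsmul_eq_mul]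
    linear_combination hb
  have key := biasObj_eq_add_of_stationary stationary
  refine ⟨fun b => ?_, fun b hb => ?_⟩
  · rw [key b]
    exact le_add_of_nonneg_right (by positivity)
  · rw [key b, add_eq_left, mul_eq_zero, or_iff_right hpos.ne',
      sum_eq_zero_iff_of_nonneg fun i _ => sq_nonneg _] at hb
    funext i
    exact sub_eq_zero.mp (pow_eq_zero_iff two_ne_zero |>.mp (hb i (mem_univ i)))
end

section
/- In the setting of the proximal alternating scheme for the SAE loss L: suppose additionally that L is bounded below by L* ∈ ℝ and that μ_enc^t, ν_enc^t, μ_dec^t, ν_dec^t ≥ a for some a > 0 and all t. Then Σ_{t=0}^∞ (‖W_enc^{t+1} − W_enc^t‖_F² + ‖b_enc^{t+1} − b_enc^t‖₂² + ‖W_dec^{t+1} − W_dec^t‖_F² + ‖b_dec^{t+1} − b_dec^t‖₂²) ≤ (L(Θ_0) − L*)/a; consequently Θ_{t+1} − Θ_t → 0 as t → ∞, and for every ε > 0 the number of indices t with ‖Θ_{t+1} − Θ_t‖ > ε is at most (L(Θ_0) − L*)/(a ε²). -/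
open Finset Filter

/-- Squared Frobenius norm. -/
def frob2 {m n : ℕ} (M : Matrix (Fin m) (Fin n) ℝ) : ℝ := ∑ i, ∑ j, (M i j) ^ 2

/-- Squared Euclidean norm. -/
def vnorm2 {n : ℕ} (v : Fin n → ℝ) : ℝ := ∑ i, (v i) ^ 2

/-- The SAE loss. -/
noncomputable def saeLoss (d n N : ℕ) (x : Fin N → Fin n → ℝ)
    (ρ : (Fin d → ℝ) → Fin d → ℝ)
    (F : Matrix (Fin d) (Fin n) ℝ → (Fin d → ℝ) → ℝ)
    (G : Matrix (Fin n) (Fin d) ℝ → (Fin n → ℝ) → ℝ)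
    (We : Matrix (Fin d) (Fin n) ℝ) (be : Fin d → ℝ)
    (Wd : Matrix (Fin n) (Fin d) ℝ) (bd : Fin n → ℝ) : ℝ :=
  (∑ r, ∑ i, (Wd.mulVec (ρ (We.mulVec (x r) + be)) i + bd i - x r i) ^ 2)
    + F We be + G Wd bd

/-- The squared norm of the full parameter step `Θ_{t+1} − Θ_t` of the PAM scheme. -/
noncomputable def stepSq (d n : ℕ)
    (We : ℕ → Matrix (Fin d) (Fin n) ℝ) (be : ℕ → Fin d → ℝ)
    (Wd : ℕ → Matrix (Fin n) (Fin d) ℝ) (bd : ℕ → Fin n → ℝ) (t : ℕ) : ℝ :=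
  frob2 (We (t+1) - We t) + vnorm2 (be (t+1) - be t)
    + frob2 (Wd (t+1) - Wd t) + vnorm2 (bd (t+1) - bd t)

theorem frob2_nonneg {m n : ℕ} (M : Matrix (Fin m) (Fin n) ℝ) : 0 ≤ frob2 M :=
  sum_nonneg fun _ _ => sum_nonneg fun _ _ => sq_nonneg _

@[simp]
theorem frob2_zero {m n : ℕ} : frob2 (0 : Matrix (Fin m) (Fin n) ℝ) = 0 := by
  simp [frob2]

theorem vnorm2_nonneg {n : ℕ} (v : Fin n → ℝ) : 0 ≤ vnorm2 v :=
  sum_nonneg fun _ _ => sq_nonneg _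

@[simp]
theorem vnorm2_zero {n : ℕ} : vnorm2 (0 : Fin n → ℝ) = 0 := by
  simp [vnorm2]

theorem stepSq_nonneg {d n : ℕ}
    (We : ℕ → Matrix (Fin d) (Fin n) ℝ) (be : ℕ → Fin d → ℝ)
    (Wd : ℕ → Matrix (Fin n) (Fin d) ℝ) (bd : ℕ → Fin n → ℝ) (t : ℕ) :
    0 ≤ stepSq d n We be Wd bd t :=
  add_nonneg (add_nonneg (add_nonneg (frob2_nonneg _) (vnorm2_nonneg _)) (frob2_nonneg _))
    (vnorm2_nonneg _)

/-- Telescoping a sufficient-decrease inequality bounds the partial sums of the decrements. -/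
theorem sum_range_le_of_sufficient_decrease {s ℓ : ℕ → ℝ} {a m : ℝ} (ha : 0 < a)
    (hm : ∀ t, m ≤ ℓ t) (hdec : ∀ t, a * s t ≤ ℓ t - ℓ (t + 1)) (T : ℕ) :
    ∑ t ∈ range T, s t ≤ (ℓ 0 - m) / a := by
  rw [le_div_iff₀' ha, mul_sum]
  calc ∑ t ∈ range T, a * s t ≤ ∑ t ∈ range T, (ℓ t - ℓ (t + 1)) :=
        sum_le_sum fun t _ => hdec t
    _ = ℓ 0 - ℓ T := sum_range_sub' ℓ T
    _ ≤ ℓ 0 - m := sub_le_sub_left (hm T) _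

/-- Markov's inequality for a summable nonnegative family. -/
theorem Summable.finite_and_ncard_mul_le_tsum {ι : Type*} {f : ι → ℝ} (hf : Summable f)
    (hf0 : ∀ i, 0 ≤ f i) {c : ℝ} (hc : 0 < c) :
    {i | c < f i}.Finite ∧ ({i | c < f i}.ncard : ℝ) * c ≤ ∑' i, f i := by
  have hfin : {i | c < f i}.Finite := by
    have h : ∀ᶠ i in cofinite, f i < c := hf.tendsto_cofinite_zero.eventually_lt_const hc
    exact (eventually_cofinite.1 h).subset fun i hi => not_lt.2 (le_of_lt hi)
  refine ⟨hfin, ?_⟩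
  rw [Set.ncard_eq_toFinset_card _ hfin, ← nsmul_eq_mul]
  exact (card_nsmul_le_sum _ _ _ fun i hi => le_of_lt (hfin.mem_toFinset.1 hi)).trans
    (hf.sum_le_tsum _ fun i _ => hf0 i)

/-- If the SAE loss is bounded below by `L*` and the proximal parameters are bounded
below by `a > 0`, then the squared parameter steps of the PAM scheme are summable with
`Σ_t ‖Θ_{t+1} − Θ_t‖² ≤ (L(Θ₀) − L*)/a`; consequently `Θ_{t+1} − Θ_t → 0`, and for every
`ε > 0` the number of `t` with `‖Θ_{t+1} − Θ_t‖ > ε` is at most `(L(Θ₀) − L*)/(a ε²)`. -/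
theorem pam_square_summable_steps
    (d n N : ℕ) (x : Fin N → Fin n → ℝ)
    (ρ : (Fin d → ℝ) → Fin d → ℝ)
    (F : Matrix (Fin d) (Fin n) ℝ → (Fin d → ℝ) → ℝ)
    (G : Matrix (Fin n) (Fin d) ℝ → (Fin n → ℝ) → ℝ)
    (Lstar : ℝ)
    (hbelow : ∀ We be Wd bd, Lstar ≤ saeLoss d n N x ρ F G We be Wd bd)
    (a : ℝ) (ha : 0 < a)
    (μe νe μd νd : ℕ → ℝ)
    (hμe : ∀ t, a ≤ μe t) (hνe : ∀ t, a ≤ νe t)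
    (hμd : ∀ t, a ≤ μd t) (hνd : ∀ t, a ≤ νd t)
    (We : ℕ → Matrix (Fin d) (Fin n) ℝ) (be : ℕ → Fin d → ℝ)
    (Wd : ℕ → Matrix (Fin n) (Fin d) ℝ) (bd : ℕ → Fin n → ℝ)
    (hEnc : ∀ t (W : Matrix (Fin d) (Fin n) ℝ) (b : Fin d → ℝ),
      saeLoss d n N x ρ F G (We (t+1)) (be (t+1)) (Wd t) (bd t)
          + μe t * frob2 (We (t+1) - We t) + νe t * vnorm2 (be (t+1) - be t)
        ≤ saeLoss d n N x ρ F G W b (Wd t) (bd t)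
          + μe t * frob2 (W - We t) + νe t * vnorm2 (b - be t))
    (hDec : ∀ t (W : Matrix (Fin n) (Fin d) ℝ) (b : Fin n → ℝ),
      saeLoss d n N x ρ F G (We (t+1)) (be (t+1)) (Wd (t+1)) (bd (t+1))
          + μd t * frob2 (Wd (t+1) - Wd t) + νd t * vnorm2 (bd (t+1) - bd t)
        ≤ saeLoss d n N x ρ F G (We (t+1)) (be (t+1)) W b
          + μd t * frob2 (W - Wd t) + νd t * vnorm2 (b - bd t)) :
    Summable (stepSq d n We be Wd bd) ∧
    (∑' t, stepSq d n We be Wd bd t)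
      ≤ (saeLoss d n N x ρ F G (We 0) (be 0) (Wd 0) (bd 0) - Lstar) / a ∧
    Tendsto (fun t => Real.sqrt (stepSq d n We be Wd bd t)) atTop (nhds 0) ∧
    (∀ ε : ℝ, 0 < ε →
      {t : ℕ | ε < Real.sqrt (stepSq d n We be Wd bd t)}.Finite ∧
      (({t : ℕ | ε < Real.sqrt (stepSq d n We be Wd bd t)}.ncard : ℝ)
        ≤ (saeLoss d n N x ρ F G (We 0) (be 0) (Wd 0) (bd 0) - Lstar) / (a * ε ^ 2))) := by
  have hnonneg := stepSq_nonneg We be Wd bd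
  have hdec : ∀ t, a * stepSq d n We be Wd bd t ≤
      saeLoss d n N x ρ F G (We t) (be t) (Wd t) (bd t)
        - saeLoss d n N x ρ F G (We (t + 1)) (be (t + 1)) (Wd (t + 1)) (bd (t + 1)) := by
    intro t
    have h₁ := hEnc t (We t) (be t)
    have h₂ := hDec t (Wd t) (bd t)
    simp only [sub_self, frob2_zero, vnorm2_zero, mul_zero, add_zero] at h₁ h₂
    have k₁ := mul_le_mul_of_nonneg_right (hμe t) (frob2_nonneg (We (t + 1) - We t))
    have k₂ := mul_le_mul_of_nonneg_right (hνe t) (vnorm2_nonneg (be (t + 1) - be t))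
    have k₃ := mul_le_mul_of_nonneg_right (hμd t) (frob2_nonneg (Wd (t + 1) - Wd t))
    have k₄ := mul_le_mul_of_nonneg_right (hνd t) (vnorm2_nonneg (bd (t + 1) - bd t))
    simp only [stepSq, mul_add]
    linarith
  have hpartial := sum_range_le_of_sufficient_decrease
    (ℓ := fun t => saeLoss d n N x ρ F G (We t) (be t) (Wd t) (bd t)) ha
    (fun t => hbelow (We t) (be t) (Wd t) (bd t)) hdec
  have hsum := summable_of_sum_range_le hnonneg hpartial
  have htsum := Real.tsum_le_of_sum_range_le hnonneg hpartial
  refine ⟨hsum, htsum, ?_, fun ε hε => ?_⟩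
  · simpa using hsum.tendsto_atTop_zero.sqrt
  · simp only [Real.lt_sqrt hε.le]
    obtain ⟨hfin, hcard⟩ := hsum.finite_and_ncard_mul_le_tsum hnonneg (pow_pos hε 2)
    refine ⟨hfin, ?_⟩
    rw [← div_div, le_div_iff₀ (pow_pos hε 2)]
    exact hcard.trans htsum
end
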